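/- Let Q ⊆ ℝⁿ be a nonempty closed convex set, g : ℝⁿ → ℝ a μ-weakly convex function (μ > 0), X* ⊆ Q a nonempty set with g(x*) ≤ 0 for all x* ∈ X*. Fix C ∈ (0,1], α > 0, γ ∈ (0,1), and a point x ∈ Q with g(x) ≥ C·α·dist(x, X*) and dist(x, X*) ≤ Cαγ/μ. Let v be a μ-weak subgradient of g at x with v ≠ 0, and set x⁺ = proj_Q(x − h·v) with h = g(x)/‖v‖₂². Then dist(x⁺, X*)² ≤ (1 − C²(1−γ)α²/‖v‖₂²)·dist(x, X*)². -/

import Mathlib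

open Metric Set RealInnerProductSpace

/-- `p` is the Euclidean (metric) projection of `z` onto the set `Q`. -/
def IsProj {n : ℕ} (Q : Set (EuclideanSpace ℝ (Fin n)))
    (z p : EuclideanSpace ℝ (Fin n)) : Prop :=
  p ∈ Q ∧ ∀ y ∈ Q, ‖p - z‖ ≤ ‖y - z‖

/-- The Euclidean projection onto a convex set does not increase the distance to its points. -/
lemma IsProj.norm_sub_le {n : ℕ} {Q : Set (EuclideanSpace ℝ (Fin n))} (hQ : Convex ℝ Q)
    {w p z : EuclideanSpace ℝ (Fin n)} (hp : IsProj Q w p) (hz : z ∈ Q) :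
    ‖p - z‖ ≤ ‖w - z‖ := by
  have : Nonempty Q := ⟨⟨p, hp.1⟩⟩
  have hinf : ‖w - p‖ = ⨅ y : Q, ‖w - y‖ := by
    refine le_antisymm (le_ciInf fun y => ?_) ?_
    · rw [norm_sub_rev w p, norm_sub_rev w y]
      exact hp.2 y y.2
    · exact ciInf_le (f := fun y : Q => ‖w - y‖)
        ⟨0, by rintro _ ⟨y, rfl⟩; exact norm_nonneg _⟩ ⟨p, hp.1⟩
  have hinner := (norm_eq_iInf_iff_real_inner_le_zero hQ hp.1).1 hinf z hz
  have hexp := norm_sub_sq_real (w - p) (z - p)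
  rw [sub_sub_sub_cancel_right, norm_sub_rev z p] at hexp
  refine le_of_sq_le_sq ?_ (norm_nonneg _)
  nlinarith [sq_nonneg ‖w - p‖]

/-- A projected Polyak step along a weak subgradient `v` at `x`, compared to a feasible point. -/
lemma IsProj.norm_sub_sq_le_of_weak_subgradient {n : ℕ} {Q : Set (EuclideanSpace ℝ (Fin n))}
    (hQ : Convex ℝ Q) {g : EuclideanSpace ℝ (Fin n) → ℝ} {μ : ℝ}
    {x v p z : EuclideanSpace ℝ (Fin n)} (hgx : 0 ≤ g x) (hv : v ≠ 0)
    (hsub : g z ≥ g x + ⟪v, z - x⟫ - μ / 2 * ‖z - x‖ ^ 2)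
    (hp : IsProj Q (x - (g x / ‖v‖ ^ 2) • v) p) (hz : z ∈ Q) (hgz : g z ≤ 0) :
    ‖p - z‖ ^ 2 ≤ ‖x - z‖ ^ 2 - g x / ‖v‖ ^ 2 * (g x - μ * ‖x - z‖ ^ 2) := by
  have hV : 0 < ‖v‖ ^ 2 := pow_pos (norm_pos_iff.2 hv) 2
  set h := g x / ‖v‖ ^ 2
  have h_nonneg : 0 ≤ h := div_nonneg hgx hV.le
  have hhV : h * ‖v‖ ^ 2 = g x := div_mul_cancel₀ _ hV.ne'
  have hle : ‖p - z‖ ^ 2 ≤ ‖x - h • v - z‖ ^ 2 :=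
    pow_le_pow_left₀ (norm_nonneg _) (hp.norm_sub_le hQ hz) 2
  have hexp : ‖x - h • v - z‖ ^ 2 = ‖x - z‖ ^ 2 - 2 * (h * ⟪v, x - z⟫) + h * g x := by
    rw [sub_right_comm, norm_sub_sq_real, real_inner_smul_right, real_inner_comm, norm_smul,
      Real.norm_eq_abs, mul_pow, sq_abs, ← hhV]
    ring
  rw [← neg_sub x z, inner_neg_right, norm_neg] at hsub
  have hinner : g x - μ / 2 * ‖x - z‖ ^ 2 ≤ ⟪v, x - z⟫ := by linarith
  nlinarith [mul_le_mul_of_nonneg_left hinner h_nonneg]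

/-- per-iteration contraction on a nonproductive step of the
conditional-sharp-minimum scheme: for μ-weakly convex `g`, μ-weak subgradient
`v ≠ 0`, step `h = g x / ‖v‖²`, assuming `g x ≥ Cα·dist(x, X*)` and
`dist(x, X*) ≤ Cαγ/μ`. -/
theorem nonproductive_step_contraction_conditional {n : ℕ}
    (Q Xstar : Set (EuclideanSpace ℝ (Fin n)))
    (hQne : Q.Nonempty) (hQc : IsClosed Q) (hQconv : Convex ℝ Q)
    (g : EuclideanSpace ℝ (Fin n) → ℝ) (μ α γ C : ℝ)
    (hμ : 0 < μ) (hα : 0 < α) (hγ : γ ∈ Set.Ioo (0:ℝ) 1) (hC : C ∈ Set.Ioc (0:ℝ) 1)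
    (hwconv : ConvexOn ℝ Set.univ (fun y => g y + μ / 2 * ‖y‖ ^ 2))
    (hXne : Xstar.Nonempty) (hXsub : Xstar ⊆ Q)
    (hXfeas : ∀ z ∈ Xstar, g z ≤ 0)
    (x v xplus : EuclideanSpace ℝ (Fin n)) (hxQ : x ∈ Q)
    (hsharp : g x ≥ C * α * Metric.infDist x Xstar)
    (hclose : Metric.infDist x Xstar ≤ C * α * γ / μ)
    (hv : v ≠ 0)
    (hsub : ∀ y, g y ≥ g x + ⟪v, y - x⟫ - μ / 2 * ‖y - x‖ ^ 2)
    (hproj : IsProj Q (x - (g x / ‖v‖ ^ 2) • v) xplus) :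
    Metric.infDist xplus Xstar ^ 2 ≤
      (1 - C ^ 2 * (1 - γ) * α ^ 2 / ‖v‖ ^ 2) * Metric.infDist x Xstar ^ 2 := by
  obtain ⟨hγ0, hγ1⟩ := hγ
  have hCα : 0 < C * α := mul_pos hC.1 hα
  have hV : 0 < ‖v‖ ^ 2 := pow_pos (norm_pos_iff.2 hv) 2
  have hd : 0 ≤ infDist x Xstar := infDist_nonneg
  have hgx : 0 ≤ g x := (mul_nonneg hCα.le hd).trans hsharp
  have hclosed : IsClosed {z | infDist xplus Xstar ^ 2 ≤
      ‖x - z‖ ^ 2 - g x / ‖v‖ ^ 2 * (g x - μ * ‖x - z‖ ^ 2)} :=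
    isClosed_le (by fun_prop) (by fun_prop)
  have hstep : closure Xstar ⊆ {z | infDist xplus Xstar ^ 2 ≤
      ‖x - z‖ ^ 2 - g x / ‖v‖ ^ 2 * (g x - μ * ‖x - z‖ ^ 2)} := by
    refine closure_minimal (fun z hz => ?_) hclosed
    refine le_trans (pow_le_pow_left₀ infDist_nonneg ?_ 2)
      (hproj.norm_sub_sq_le_of_weak_subgradient hQconv hgx hv (hsub z) (hXsub hz) (hXfeas z hz))
    rw [← dist_eq_norm]
    exact infDist_le_dist_of_mem hz
  obtain ⟨z, hz, hxz⟩ := isClosed_closure.exists_infDist_eq_dist hXne.closure x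
  rw [infDist_closure, dist_eq_norm] at hxz
  refine (hstep hz).trans ?_
  rw [← hxz]
  set d := infDist x Xstar
  have hμd : μ * d ≤ C * α * γ := by
    rw [mul_comm]
    exact (le_div_iff₀ hμ).1 hclose
  have hμd2 : μ * d ^ 2 ≤ γ * g x := by
    nlinarith [mul_le_mul_of_nonneg_right hμd hd, mul_le_mul_of_nonneg_left hsharp hγ0.le]
  have hsq : (C * α * d) ^ 2 ≤ g x ^ 2 :=
    pow_le_pow_left₀ (mul_nonneg hCα.le hd) hsharp 2
  have hkey : C ^ 2 * (1 - γ) * α ^ 2 * d ^ 2 ≤ g x * (g x - μ * d ^ 2) := by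
    nlinarith [mul_le_mul_of_nonneg_left hμd2 hgx,
      mul_le_mul_of_nonneg_left hsq (sub_nonneg.2 hγ1.le)]
  rw [div_mul_eq_mul_div, sub_mul, one_mul, div_mul_eq_mul_div]
  gcongr
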